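/- Let f : [a, b] → ℝ be three times differentiable with 0 < Λ ≤ f'''(x) ≤ cΛ for all x ∈ [a, b], where b ≥ a + 1 and c > 1. Then |∑_{a < n ≤ b} e^{2πi f(n)}| ≤ C (c^{1/2} (b − a) Λ^{1/6} + (b − a)^{1/2} Λ^{−1/6}) for an absolute constant C. -/

import Mathlib

open Complex

/-- The additive character `x ↦ exp (2πix)` on the real line. -/
noncomputable def unitExp (x : ℝ) : ℂ := Complex.exp (2 * Real.pi * I * x)

lemma norm_unitExp (x : ℝ) : ‖unitExp x‖ = 1 := by
  have h : (2 * Real.pi * I * x : ℂ) = ((2 * Real.pi * x : ℝ) : ℂ) * I := by push_cast; ring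
  rw [unitExp, h, norm_exp_ofReal_mul_I]

lemma unitExp_add (x y : ℝ) : unitExp (x + y) = unitExp x * unitExp y := by
  rw [unitExp, unitExp, unitExp, ← Complex.exp_add]
  push_cast
  ring_nf

lemma unitExp_intCast (k : ℤ) : unitExp k = 1 := by
  rw [unitExp, Complex.exp_eq_one_iff]
  exact ⟨k, by push_cast; ring⟩

lemma unitExp_sub (x y : ℝ) :
    unitExp (x - y) = unitExp x * (starRingEnd ℂ) (unitExp y) := by
  have h : (starRingEnd ℂ) (unitExp y) = unitExp (-y) := by
    rw [unitExp, unitExp, ← Complex.exp_conj]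
    simp [Complex.conj_ofNat]
  rw [h, ← unitExp_add, sub_eq_add_neg]

lemma norm_sum_unitExp_le_card {ι : Type*} (s : Finset ι) (φ : ι → ℝ) :
    ‖∑ n ∈ s, unitExp (φ n)‖ ≤ s.card := by
  refine (norm_sum_le _ _).trans ?_
  simp [norm_unitExp]

lemma cot_le_cot {x y : ℝ} (hx : 0 < x) (hxy : x ≤ y) (hy : y < Real.pi) :
    Real.cot y ≤ Real.cot x := by
  have hsx := Real.sin_pos_of_pos_of_lt_pi hx (hxy.trans_lt hy)
  have hsy := Real.sin_pos_of_pos_of_lt_pi (hx.trans_le hxy) hy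
  rw [Real.cot_eq_cos_div_sin, Real.cot_eq_cos_div_sin, div_le_div_iff₀ hsy hsx]
  have h := Real.sin_nonneg_of_nonneg_of_le_pi (sub_nonneg.2 hxy) (by linarith)
  rw [Real.sin_sub] at h
  linarith

lemma two_mul_le_sin_pi_mul {θ x : ℝ} (hθ : 0 < θ) (h₁ : θ ≤ x) (h₂ : x ≤ 1 - θ) :
    2 * θ ≤ Real.sin (Real.pi * x) := by
  have hπ := Real.pi_pos
  rcases le_total x (1 / 2) with h | h
  · have := Real.mul_le_sin (x := Real.pi * x) (by nlinarith) (by nlinarith)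
    have e : 2 / Real.pi * (Real.pi * x) = 2 * x := by field_simp
    linarith
  · have := Real.mul_le_sin (x := Real.pi - Real.pi * x) (by nlinarith) (by nlinarith)
    have e : 2 / Real.pi * (Real.pi - Real.pi * x) = 2 * (1 - x) := by field_simp
    rw [Real.sin_pi_sub] at this
    linarith

lemma abs_cot_pi_mul_le {θ x : ℝ} (hθ : 0 < θ) (h₁ : θ ≤ x) (h₂ : x ≤ 1 - θ) :
    |Real.cot (Real.pi * x)| ≤ 1 / (2 * θ) := by
  have hs := two_mul_le_sin_pi_mul hθ h₁ h₂
  rw [Real.cot_eq_cos_div_sin, abs_div, abs_of_pos (a := Real.sin _) (by linarith)]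
  exact div_le_div₀ zero_le_one (Real.abs_cos_le_one _) (by linarith) hs

lemma unitExp_sub_one_mul_cot {x : ℝ} (hs : Real.sin (Real.pi * x) ≠ 0) :
    (unitExp x - 1) * (-(1 / 2) - I * ((Real.cot (Real.pi * x) / 2 : ℝ) : ℂ)) = 1 := by
  have h : unitExp x = ((Real.cos (Real.pi * x) : ℂ) + (Real.sin (Real.pi * x) : ℂ) * I) ^ 2 := by
    have e : (2 * Real.pi * I * x : ℂ) = (2 : ℕ) * (((Real.pi * x : ℝ) : ℂ) * I) := by
      push_cast; ring
    rw [unitExp, e, Complex.exp_nat_mul, Complex.exp_mul_I]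
    simp
  have hs' : (Real.sin (Real.pi * x) : ℂ) ≠ 0 := by exact_mod_cast hs
  have hsc : (Real.sin (Real.pi * x) : ℂ) ^ 2 + (Real.cos (Real.pi * x) : ℂ) ^ 2 = 1 := by
    exact_mod_cast Real.sin_sq_add_cos_sq (Real.pi * x)
  rw [h, Real.cot_eq_cos_div_sin, ofReal_div, ofReal_div]
  generalize (Real.sin (Real.pi * x) : ℂ) = s at *
  generalize (Real.cos (Real.pi * x) : ℂ) = c at *
  have hI : I ^ 2 = -1 := I_sq
  have hc : c ^ 2 = 1 - s ^ 2 := by linear_combination hsc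
  have h2 : (c + s * I) ^ 2 - 1 = 2 * I * s * (c + s * I) := by
    linear_combination hsc - s ^ 2 * hI
  rw [h2]
  push_cast
  field_simp
  linear_combination (-(s ^ 2) - c ^ 2 - s * c * I) * hI + hsc

/-- The **Kusmin–Landau inequality** for sequences with increasing differences in
`[θ, 1 - θ]`. -/
lemma norm_sum_unitExp_le_of_diff_mem_zero_one {φ : ℕ → ℝ} {θ : ℝ} {N : ℕ} (hθ : 0 < θ)
    (hmono : Monotone fun n ↦ φ (n + 1) - φ n)
    (h₁ : ∀ n < N, θ ≤ φ (n + 1) - φ n) (h₂ : ∀ n < N, φ (n + 1) - φ n ≤ 1 - θ) :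
    ‖∑ n ∈ Finset.range N, unitExp (φ n)‖ ≤ 2 / θ := by
  have hπ := Real.pi_pos
  rcases N with _ | N
  · simp; positivity
  set u : ℕ → ℝ := fun n ↦ Real.cot (Real.pi * (φ (n + 1) - φ n)) / 2 with hu
  set w : ℕ → ℂ := fun n ↦ -(1 / 2) - I * (u n : ℂ) with hw
  have hz : ∀ n < N + 1, unitExp (φ n) = (unitExp (φ (n + 1)) - unitExp (φ n)) * w n := by
    intro n hn
    have hs := two_mul_le_sin_pi_mul hθ (h₁ n hn) (h₂ n hn)
    have e := unitExp_sub_one_mul_cot (x := φ (n + 1) - φ n) (by linarith)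
    have e' : unitExp (φ (n + 1)) = unitExp (φ n) * unitExp (φ (n + 1) - φ n) := by
      rw [← unitExp_add]; congr 1; ring
    rw [e']
    simp only [hw, hu]
    linear_combination (-unitExp (φ n)) * e
  have hparts : ∀ M ≤ N, ∑ n ∈ Finset.range (M + 1), unitExp (φ n) =
      unitExp (φ (M + 1)) * w M - unitExp (φ 0) * w 0 -
        ∑ n ∈ Finset.range M, unitExp (φ (n + 1)) * (w (n + 1) - w n) := by
    intro M
    induction M with
    | zero =>
      intro _
      have := hz 0 (by omega)
      simp only [zero_add, Finset.range_one, Finset.sum_singleton, Finset.range_zero,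
        Finset.sum_empty] at *
      linear_combination this
    | succ M ih =>
      intro hM
      rw [Finset.sum_range_succ, ih (by omega), Finset.sum_range_succ _ M]
      linear_combination hz (M + 1) (by omega)
  have hub : ∀ n < N + 1, |u n| ≤ 1 / (4 * θ) := by
    intro n hn
    have := abs_cot_pi_mul_le hθ (h₁ n hn) (h₂ n hn)
    simp only [hu, abs_div, abs_two]
    calc _ ≤ 1 / (2 * θ) / 2 := by gcongr
      _ = _ := by field_simp; norm_num
  have hθ2 : θ ≤ 1 / 2 := by linarith [h₁ 0 (by omega), h₂ 0 (by omega)]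
  have hhalf : 1 / 2 ≤ 1 / (4 * θ) := one_div_le_one_div_of_le (by positivity) (by linarith)
  have hwb : ∀ n < N + 1, ‖w n‖ ≤ 1 / (2 * θ) := by
    intro n hn
    calc ‖w n‖ ≤ ‖(-(1 / 2) : ℂ)‖ + ‖I * (u n : ℂ)‖ := norm_sub_le _ _
      _ = 1 / 2 + |u n| := by simp
      _ ≤ 1 / (4 * θ) + 1 / (4 * θ) := add_le_add hhalf (hub n hn)
      _ = 1 / (2 * θ) := by field_simp; norm_num
  have hvar : ∀ n < N, ‖unitExp (φ (n + 1)) * (w (n + 1) - w n)‖ = u n - u (n + 1) := by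
    intro n hn
    have e : w (n + 1) - w n = I * ((u n - u (n + 1) : ℝ) : ℂ) := by
      simp only [hw]; push_cast; ring
    have a₁ := h₁ n (by omega)
    have a₂ := h₂ (n + 1) (by omega)
    have a₃ : φ (n + 1) - φ n ≤ φ (n + 1 + 1) - φ (n + 1) := hmono (Nat.le_succ n)
    rw [norm_mul, norm_unitExp, e, norm_mul, norm_I, one_mul, one_mul, norm_real,
      Real.norm_of_nonneg]
    have := cot_le_cot (x := Real.pi * (φ (n + 1) - φ n))
      (y := Real.pi * (φ (n + 1 + 1) - φ (n + 1))) (by apply mul_pos <;> linarith)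
      (by gcongr) (by nlinarith)
    simp only [hu]
    linarith
  have hsum : ‖∑ n ∈ Finset.range N, unitExp (φ (n + 1)) * (w (n + 1) - w n)‖ ≤ u 0 - u N := by
    rw [← Finset.sum_range_sub']
    exact (norm_sum_le _ _).trans
      (Finset.sum_le_sum fun n hn ↦ (hvar n (Finset.mem_range.1 hn)).le)
  rw [hparts N le_rfl]
  calc _ ≤ ‖unitExp (φ (N + 1)) * w N‖ + ‖unitExp (φ 0) * w 0‖ +
        ‖∑ n ∈ Finset.range N, unitExp (φ (n + 1)) * (w (n + 1) - w n)‖ :=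
        (norm_sub_le _ _).trans (by gcongr; exact norm_sub_le _ _)
    _ ≤ 1 / (2 * θ) + 1 / (2 * θ) + (1 / (4 * θ) + 1 / (4 * θ)) := by
        rw [norm_mul, norm_mul, norm_unitExp, norm_unitExp, one_mul, one_mul]
        have := abs_le.1 (hub 0 (by omega))
        have := abs_le.1 (hub N (by omega))
        have := hwb 0 (by omega)
        have := hwb N (by omega)
        linarith
    _ ≤ 2 / θ := by
        have : 0 < 1 / θ := by positivity
        have e : 1 / (2 * θ) + 1 / (2 * θ) + (1 / (4 * θ) + 1 / (4 * θ)) = 3 / 2 * (1 / θ) := by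
          field_simp; norm_num
        rw [e, show 2 / θ = 2 * (1 / θ) by ring]
        linarith

lemma norm_sum_range_unitExp_le {φ : ℕ → ℝ} {θ : ℝ} {N : ℕ} (k : ℤ) (hθ : 0 < θ)
    (hmono : Monotone fun n ↦ φ (n + 1) - φ n)
    (h₁ : ∀ n < N, k + θ ≤ φ (n + 1) - φ n) (h₂ : ∀ n < N, φ (n + 1) - φ n ≤ k + 1 - θ) :
    ‖∑ n ∈ Finset.range N, unitExp (φ n)‖ ≤ 2 / θ := by
  have hd : ∀ n : ℕ, φ (n + 1) - k * (n + 1 : ℕ) - (φ n - k * n) = φ (n + 1) - φ n - k := by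
    intro n; push_cast; ring
  have h := norm_sum_unitExp_le_of_diff_mem_zero_one (φ := fun n ↦ φ n - k * n) (N := N) hθ
    (fun m n hmn ↦ by simpa only [hd, sub_le_sub_iff_right] using hmono hmn)
    (fun n hn ↦ by simp only [hd]; linarith [h₁ n hn])
    (fun n hn ↦ by simp only [hd]; linarith [h₂ n hn])
  convert h using 3 with n
  have e : φ n = (φ n - k * n) + ((k * n : ℤ) : ℝ) := by push_cast; ring
  conv_lhs => rw [e, unitExp_add, unitExp_intCast, mul_one]

lemma Finset.exists_eq_Ico_of_ordConnected (s : Finset ℕ)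
    (hs : ∀ x ∈ s, ∀ z ∈ s, ∀ y, x ≤ y → y ≤ z → y ∈ s) : ∃ m L, s = Finset.Ico m (m + L) := by
  rcases s.eq_empty_or_nonempty with rfl | hne
  · exact ⟨0, 0, by simp⟩
  · have hle : s.min' hne ≤ s.max' hne := s.min'_le _ (s.max'_mem hne)
    refine ⟨s.min' hne, s.max' hne - s.min' hne + 1, ?_⟩
    ext y
    rw [Finset.mem_Ico]
    constructor
    · intro hy
      have := s.min'_le y hy
      have := s.le_max' y hy
      omega
    · intro hy
      exact hs _ (s.min'_mem hne) _ (s.max'_mem hne) y hy.1 (by omega)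

lemma norm_sum_unitExp_le_of_ordConnected {φ : ℕ → ℝ} {θ : ℝ} (k : ℤ) (hθ : 0 < θ)
    (hmono : Monotone fun n ↦ φ (n + 1) - φ n) (s : Finset ℕ)
    (hs : ∀ x ∈ s, ∀ z ∈ s, ∀ y, x ≤ y → y ≤ z → y ∈ s)
    (h₁ : ∀ n ∈ s, k + θ ≤ φ (n + 1) - φ n) (h₂ : ∀ n ∈ s, φ (n + 1) - φ n ≤ k + 1 - θ) :
    ‖∑ n ∈ s, unitExp (φ n)‖ ≤ 2 / θ := by
  obtain ⟨m, L, rfl⟩ := s.exists_eq_Ico_of_ordConnected hs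
  rw [Finset.sum_Ico_eq_sum_range, Nat.add_sub_cancel_left]
  exact norm_sum_range_unitExp_le (φ := fun n ↦ φ (m + n)) k hθ
    (fun i j hij ↦ hmono (Nat.add_le_add_left hij m))
    (fun n hn ↦ h₁ (m + n) (by simp [hn])) (fun n hn ↦ h₂ (m + n) (by simp [hn]))

lemma mul_sub_le_sub_of_forall_le_succ {δ : ℕ → ℝ} {l : ℝ} (h : ∀ n, l ≤ δ (n + 1) - δ n)
    (m j : ℕ) : l * j ≤ δ (m + j) - δ m := by
  induction j with
  | zero => simp
  | succ j ih =>
    have := h (m + j)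
    rw [← add_assoc]
    push_cast
    linarith

lemma sub_le_mul_sub_of_forall_succ_le {δ : ℕ → ℝ} {l : ℝ} (h : ∀ n, δ (n + 1) - δ n ≤ l)
    (m j : ℕ) : δ (m + j) - δ m ≤ l * j := by
  have := mul_sub_le_sub_of_forall_le_succ (δ := fun n ↦ -δ n) (l := -l)
    (fun n ↦ by linarith [h n]) m j
  linarith

lemma card_le_of_forall_mem_Icc {δ : ℕ → ℝ} {l p θ : ℝ} (hl : 0 < l) (hθ : 0 ≤ θ)
    (h : ∀ n, l ≤ δ (n + 1) - δ n)
    (s : Finset ℕ) (hs : ∀ x ∈ s, ∀ z ∈ s, ∀ y, x ≤ y → y ≤ z → y ∈ s)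
    (hp : ∀ n ∈ s, p ≤ δ n ∧ δ n ≤ p + θ) : (s.card : ℝ) ≤ θ / l + 1 := by
  obtain ⟨m, L, rfl⟩ := s.exists_eq_Ico_of_ordConnected hs
  rcases L with _ | L
  · simp; positivity
  · have a := hp m (by simp)
    have b := hp (m + L) (by simp)
    have c := mul_sub_le_sub_of_forall_le_succ h m L
    have : (L : ℝ) ≤ θ / l := by rw [le_div_iff₀ hl]; linarith
    simp [this]

/-- The second-derivative test for a sequence whose second differences lie in `[l, h * l]`. -/
lemma norm_sum_unitExp_le_of_second_diff {φ : ℕ → ℝ} {l h : ℝ} (hl : 0 < l) (hh : 1 ≤ h)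
    (h₁ : ∀ n, l ≤ (φ (n + 2) - φ (n + 1)) - (φ (n + 1) - φ n))
    (h₂ : ∀ n, (φ (n + 2) - φ (n + 1)) - (φ (n + 1) - φ n) ≤ h * l) (N : ℕ) :
    ‖∑ n ∈ Finset.range N, unitExp (φ n)‖ ≤ 12 * (h * N * √l + 1 / √l) := by
  set θ := √l with hθdef
  have hθ : 0 < θ := Real.sqrt_pos.2 hl
  have hθl : l = θ * θ := (Real.mul_self_sqrt hl.le).symm
  have hN0 : (0 : ℝ) ≤ N := N.cast_nonneg
  rcases le_total 1 l with hl1 | hl1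
  · have hθ1 : 1 ≤ θ := Real.one_le_sqrt.2 hl1
    have := norm_sum_unitExp_le_card (Finset.range N) φ
    rw [Finset.card_range] at this
    have a : (N : ℝ) ≤ h * N := le_mul_of_one_le_left hN0 hh
    have b : h * N ≤ h * N * θ := le_mul_of_one_le_right (by positivity) hθ1
    have : 0 < 1 / θ := by positivity
    linarith
  have hθ1 : θ ≤ 1 := Real.sqrt_le_one.2 hl1
  set δ : ℕ → ℝ := fun n ↦ φ (n + 1) - φ n with hδ
  have hδ₁ : ∀ n, l ≤ δ (n + 1) - δ n := h₁
  have hδ₂ : ∀ n, δ (n + 1) - δ n ≤ h * l := h₂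
  have hmono : Monotone δ := monotone_nat_of_le_succ fun n ↦ by linarith [hδ₁ n]
  have hone : 1 ≤ 1 / θ := by rw [le_div_iff₀ hθ]; linarith
  have hdiv : θ / l = 1 / θ := by rw [hθl]; field_simp
  have hblock : ∀ k : ℤ,
      ‖∑ n ∈ Finset.range N with ⌊δ n⌋ = k, unitExp (φ n)‖ ≤ 6 / θ := by
    intro k
    set s := {n ∈ Finset.range N | ⌊δ n⌋ = k} with hs
    have hmem : ∀ n, n ∈ s ↔ n < N ∧ (k : ℝ) ≤ δ n ∧ δ n < k + 1 := by
      intro n; simp [hs, Int.floor_eq_iff]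
    rw [← Finset.sum_filter_add_sum_filter_not s (fun n ↦ δ n < k + θ),
      ← Finset.sum_filter_add_sum_filter_not {n ∈ s | ¬ δ n < k + θ} (fun n ↦ δ n ≤ k + 1 - θ)]
    have hA : ‖∑ n ∈ s with δ n < k + θ, unitExp (φ n)‖ ≤ 1 / θ + 1 := by
      refine (norm_sum_unitExp_le_card _ _).trans ?_
      rw [← hdiv]
      refine card_le_of_forall_mem_Icc (p := k) hl hθ.le hδ₁ _ ?_ ?_
      · simp only [Finset.mem_filter, hmem]
        intro x hx z hz y hxy hyz
        have := hmono hxy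
        have := hmono hyz
        refine ⟨⟨by omega, ?_, ?_⟩, ?_⟩ <;> linarith
      · simp only [Finset.mem_filter, hmem]
        intro n hn
        constructor <;> linarith
    have hB : ‖∑ n ∈ {n ∈ s | ¬ δ n < k + θ} with δ n ≤ k + 1 - θ, unitExp (φ n)‖ ≤ 2 / θ := by
      refine norm_sum_unitExp_le_of_ordConnected k hθ hmono _ ?_ ?_ ?_
      · simp only [Finset.mem_filter, hmem, not_lt]
        intro x hx z hz y hxy hyz
        have := hmono hxy
        have := hmono hyz
        refine ⟨⟨⟨by omega, ?_, ?_⟩, ?_⟩, ?_⟩ <;> linarith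
      · simp only [Finset.mem_filter, not_lt]
        exact fun n hn ↦ hn.1.2
      · simp only [Finset.mem_filter, not_lt]
        exact fun n hn ↦ hn.2
    have hC : ‖∑ n ∈ {n ∈ s | ¬ δ n < k + θ} with ¬ δ n ≤ k + 1 - θ, unitExp (φ n)‖ ≤
        1 / θ + 1 := by
      refine (norm_sum_unitExp_le_card _ _).trans ?_
      rw [← hdiv]
      refine card_le_of_forall_mem_Icc (p := k + 1 - θ) hl hθ.le hδ₁ _ ?_ ?_
      · simp only [Finset.mem_filter, hmem, not_lt, not_le]
        intro x hx z hz y hxy hyz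
        have := hmono hxy
        have := hmono hyz
        refine ⟨⟨⟨by omega, ?_, ?_⟩, ?_⟩, ?_⟩ <;> linarith
      · simp only [Finset.mem_filter, hmem, not_lt, not_le]
        intro n hn
        constructor <;> linarith
    refine (norm_add_le _ _).trans ?_
    have := norm_add_le (∑ n ∈ {n ∈ s | ¬ δ n < k + θ} with δ n ≤ k + 1 - θ, unitExp (φ n))
      (∑ n ∈ {n ∈ s | ¬ δ n < k + θ} with ¬ δ n ≤ k + 1 - θ, unitExp (φ n))
    rw [show 2 / θ = 2 * (1 / θ) by ring] at hB
    rw [show 6 / θ = 6 * (1 / θ) by ring]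
    linarith
  have hmaps : ∀ n ∈ Finset.range N, ⌊δ n⌋ ∈ Finset.Icc ⌊δ 0⌋ ⌊δ N⌋ := by
    intro n hn
    rw [Finset.mem_Icc]
    exact ⟨Int.floor_mono (hmono n.zero_le), Int.floor_mono (hmono (Finset.mem_range.1 hn).le)⟩
  have hcard : ((Finset.Icc ⌊δ 0⌋ ⌊δ N⌋).card : ℝ) ≤ h * l * N + 2 := by
    have hle : ⌊δ 0⌋ ≤ ⌊δ N⌋ := Int.floor_mono (hmono N.zero_le)
    have e : ((Finset.Icc ⌊δ 0⌋ ⌊δ N⌋).card : ℝ) = ⌊δ N⌋ + 1 - ⌊δ 0⌋ := by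
      rw [Int.card_Icc, ← Int.cast_natCast, Int.toNat_of_nonneg (by omega)]
      push_cast; ring
    have a := sub_le_mul_sub_of_forall_succ_le hδ₂ 0 N
    rw [zero_add] at a
    have := Int.floor_le (δ N)
    have := Int.lt_floor_add_one (δ 0)
    rw [e]
    linarith
  rw [← Finset.sum_fiberwise_of_maps_to hmaps]
  calc _ ≤ ∑ k ∈ Finset.Icc ⌊δ 0⌋ ⌊δ N⌋, 6 / θ :=
        (norm_sum_le _ _).trans (Finset.sum_le_sum fun k _ ↦ hblock k)
    _ = (Finset.Icc ⌊δ 0⌋ ⌊δ N⌋).card * (6 / θ) := by rw [Finset.sum_const, nsmul_eq_mul]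
    _ ≤ (h * l * N + 2) * (6 / θ) := by gcongr
    _ = 6 * (h * N * θ) + 12 * (1 / θ) := by rw [hθl]; field_simp; ring
    _ ≤ 12 * (h * N * θ + 1 / θ) := by
        have : 0 ≤ h * N * θ := by positivity
        linarith

lemma sum_Ico_shift_eq_sum_range {Y : ℤ → ℂ} {N Q j : ℕ} (hj : j < Q)
    (hY : ∀ m, m < 0 ∨ (N : ℤ) ≤ m → Y m = 0) :
    ∑ m ∈ Finset.Ico (-Q : ℤ) N, Y (m + j) = ∑ n ∈ Finset.range N, Y n := by
  symm
  refine Finset.sum_of_injOn (fun n : ℕ ↦ (n : ℤ) - j) ?_ ?_ ?_ ?_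
  · intro m _ n _ h
    simpa using h
  · intro n hn
    simp only [Finset.coe_range, Set.mem_Iio] at hn
    simp only [Finset.coe_Ico, Set.mem_Ico]
    omega
  · intro m _ hm
    apply hY
    by_contra! hc
    refine hm ⟨(m + j).toNat, ?_, ?_⟩
    · simp only [Finset.coe_range, Set.mem_Iio]; omega
    · simp only; omega
  · intro n _
    simp

lemma sum_sum_range_dist_le {b : ℕ → ℝ} {Q : ℕ} (hb : ∀ r < Q, 0 ≤ b r) :
    ∑ i ∈ Finset.range Q, ∑ j ∈ Finset.range Q, b (Nat.dist i j) ≤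
      Q * (2 * ∑ r ∈ Finset.range Q, b r) := by
  have hrow : ∀ i ∈ Finset.range Q,
      ∑ j ∈ Finset.range Q, b (Nat.dist i j) ≤ 2 * ∑ r ∈ Finset.range Q, b r := by
    intro i hi
    rw [Finset.mem_range] at hi
    have hinj : ∀ s ⊆ Finset.range Q, Set.InjOn (Nat.dist i) s →
        ∑ j ∈ s, b (Nat.dist i j) ≤ ∑ r ∈ Finset.range Q, b r := by
      intro s hs hinj
      rw [← Finset.sum_image hinj]
      refine Finset.sum_le_sum_of_subset_of_nonneg ?_
        fun r hr _ ↦ hb r (Finset.mem_range.1 hr)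
      intro r hr
      obtain ⟨j, hj, rfl⟩ := Finset.mem_image.1 hr
      have := Finset.mem_range.1 (hs hj)
      rw [Finset.mem_range, Nat.dist]
      omega
    rw [← Finset.sum_filter_add_sum_filter_not (Finset.range Q) (fun j ↦ j ≤ i), two_mul]
    refine add_le_add (hinj _ (Finset.filter_subset _ _) ?_)
      (hinj _ (Finset.filter_subset _ _) ?_) <;>
    · intro x hx y hy hxy
      simp only [Finset.coe_filter, Set.mem_ofPred_eq, Nat.dist] at hx hy hxy
      omega
  calc _ ≤ ∑ i ∈ Finset.range Q, 2 * ∑ r ∈ Finset.range Q, b r := Finset.sum_le_sum hrow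
    _ = _ := by rw [Finset.sum_const, Finset.card_range, nsmul_eq_mul]

/-- The **van der Corput inequality**. -/
lemma van_der_corput_inequality {z : ℕ → ℂ} {b : ℕ → ℝ} {N Q : ℕ} (hQ : 0 < Q)
    (hb : ∀ r < Q, ‖∑ n ∈ Finset.range (N - r), z (n + r) * (starRingEnd ℂ) (z n)‖ ≤ b r) :
    Q * ‖∑ n ∈ Finset.range N, z n‖ ^ 2 ≤ 2 * (N + Q) * ∑ r ∈ Finset.range Q, b r := by
  set y : ℤ → ℂ := fun m ↦ if 0 ≤ m ∧ m < N then z m.toNat else 0 with hy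
  have hy0 : ∀ m, m < 0 ∨ (N : ℤ) ≤ m → y m = 0 := fun m hm ↦ if_neg (by omega)
  have hyz : ∀ n : ℕ, n < N → y n = z n := by
    intro n hn
    simp [hy, hn]
  set A := Finset.Ico (-Q : ℤ) N with hA
  set G : ℕ → ℕ → ℂ := fun i j ↦ ∑ m ∈ A, y (m + i) * (starRingEnd ℂ) (y (m + j)) with hG
  have hGle : ∀ i < Q, ∀ j ≤ i, ‖G i j‖ ≤ b (i - j) := by
    intro i hi j hji
    have e : G i j =
        ∑ n ∈ Finset.range (N - (i - j)), z (n + (i - j)) * (starRingEnd ℂ) (z n) := by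
      have := sum_Ico_shift_eq_sum_range (j := j) (N := N)
        (Y := fun m ↦ y (m + ((i - j : ℕ) : ℤ)) * (starRingEnd ℂ) (y m)) (hji.trans_lt hi)
        (fun m hm ↦ by simp [hy0 m hm])
      have hsub : Finset.range (N - (i - j)) ⊆ Finset.range N :=
        Finset.range_mono (Nat.sub_le _ _)
      calc G i j = ∑ m ∈ A, y (m + j + ((i - j : ℕ) : ℤ)) * (starRingEnd ℂ) (y (m + j)) := by
            refine Finset.sum_congr rfl fun m _ ↦ ?_
            rw [show m + (j : ℤ) + ((i - j : ℕ) : ℤ) = m + i by omega]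
        _ = _ := this
        _ = ∑ n ∈ Finset.range (N - (i - j)),
              y (n + ((i - j : ℕ) : ℤ)) * (starRingEnd ℂ) (y n) := by
            refine (Finset.sum_subset hsub fun n _ hn ↦ ?_).symm
            rw [Finset.mem_range] at hn
            rw [hy0 _ (by omega), zero_mul]
        _ = _ := by
            refine Finset.sum_congr rfl fun n hn ↦ ?_
            rw [Finset.mem_range] at hn
            rw [hyz n (by omega), ← Nat.cast_add, hyz _ (by omega)]
    rw [e]
    exact hb _ (by omega)
  have hGdist : ∀ i < Q, ∀ j < Q, ‖G i j‖ ≤ b (Nat.dist i j) := by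
    intro i hi j hj
    rcases le_total j i with h | h
    · rw [Nat.dist_eq_sub_of_le_right h]
      exact hGle i hi j h
    · rw [Nat.dist_eq_sub_of_le h]
      have : G i j = (starRingEnd ℂ) (G j i) := by
        simp only [hG, map_sum, map_mul, Complex.conj_conj]
        exact Finset.sum_congr rfl fun m _ ↦ mul_comm _ _
      rw [this, RCLike.norm_conj]
      exact hGle j hj i h
  have hS : (Q : ℂ) * ∑ n ∈ Finset.range N, z n =
      ∑ m ∈ A, ∑ j ∈ Finset.range Q, y (m + j) := by
    rw [Finset.sum_comm, Finset.sum_congr rfl fun j hj ↦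
      sum_Ico_shift_eq_sum_range (Finset.mem_range.1 hj) hy0]
    rw [Finset.sum_const, Finset.card_range, nsmul_eq_mul,
      Finset.sum_congr rfl fun n hn ↦ hyz n (Finset.mem_range.1 hn)]
  have hsq : ∑ m ∈ A, ‖∑ j ∈ Finset.range Q, y (m + j)‖ ^ 2 ≤
      ∑ i ∈ Finset.range Q, ∑ j ∈ Finset.range Q, b (Nat.dist i j) := by
    have e : ((∑ m ∈ A, ‖∑ j ∈ Finset.range Q, y (m + j)‖ ^ 2 : ℝ) : ℂ) =
        ∑ i ∈ Finset.range Q, ∑ j ∈ Finset.range Q, G i j := by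
      simp only [hG]
      rw [Finset.sum_congr rfl fun i _ ↦ Finset.sum_comm, Finset.sum_comm]
      push_cast
      refine Finset.sum_congr rfl fun m _ ↦ ?_
      rw [← Complex.mul_conj', map_sum, Finset.sum_mul_sum]
    calc _ = ‖((∑ m ∈ A, ‖∑ j ∈ Finset.range Q, y (m + j)‖ ^ 2 : ℝ) : ℂ)‖ := by
          rw [norm_real, Real.norm_of_nonneg (by positivity)]
      _ ≤ _ := by
          rw [e]
          refine (norm_sum_le _ _).trans (Finset.sum_le_sum fun i hi ↦ ?_)
          refine (norm_sum_le _ _).trans (Finset.sum_le_sum fun j hj ↦ ?_)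
          exact hGdist i (Finset.mem_range.1 hi) j (Finset.mem_range.1 hj)
  have hcardA : (A.card : ℝ) = N + Q := by
    rw [hA, Int.card_Ico, ← Int.cast_natCast, Int.toNat_of_nonneg (by omega)]
    push_cast; ring
  have hQ' : (0 : ℝ) < Q := Nat.cast_pos.2 hQ
  have key : (Q * ‖∑ n ∈ Finset.range N, z n‖) ^ 2 ≤
      (N + Q) * (Q * (2 * ∑ r ∈ Finset.range Q, b r)) := by
    calc (Q * ‖∑ n ∈ Finset.range N, z n‖) ^ 2
        = ‖∑ m ∈ A, ∑ j ∈ Finset.range Q, y (m + j)‖ ^ 2 := by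
          rw [← hS, norm_mul, Complex.norm_natCast]
      _ ≤ (∑ m ∈ A, ‖∑ j ∈ Finset.range Q, y (m + j)‖) ^ 2 := by
          gcongr; exact norm_sum_le _ _
      _ ≤ A.card * ∑ m ∈ A, ‖∑ j ∈ Finset.range Q, y (m + j)‖ ^ 2 := sq_sum_le_card_mul_sum_sq
      _ ≤ _ := by
          rw [hcardA]
          gcongr
          exact hsq.trans (sum_sum_range_dist_le fun r hr ↦ (norm_nonneg _).trans (hb r hr))
  refine le_of_mul_le_mul_left ?_ hQ'
  linarith

lemma sum_range_succ_inv_sqrt_le (Q : ℕ) :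
    ∑ r ∈ Finset.range (Q + 1), 1 / √(r : ℝ) ≤ 2 * √(Q : ℝ) := by
  induction Q with
  | zero => simp
  | succ Q ih =>
    rw [Finset.sum_range_succ]
    have ht : 0 < √((Q + 1 : ℕ) : ℝ) := Real.sqrt_pos.2 (by positivity)
    have ht2 := Real.sq_sqrt (Nat.cast_nonneg (α := ℝ) (Q + 1))
    have hs2 := Real.sq_sqrt (Nat.cast_nonneg (α := ℝ) Q)
    rw [Nat.cast_add_one] at ht2
    have h : 1 / √((Q + 1 : ℕ) : ℝ) ≤ 2 * √((Q + 1 : ℕ) : ℝ) - 2 * √(Q : ℝ) := by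
      rw [div_le_iff₀ ht]
      push_cast at *
      nlinarith [sq_nonneg (√((Q : ℝ) + 1) - √(Q : ℝ))]
    linarith

lemma sum_range_inv_sqrt_le (Q : ℕ) : ∑ r ∈ Finset.range Q, 1 / √(r : ℝ) ≤ 2 * √(Q : ℝ) := by
  refine (Finset.sum_le_sum_of_subset_of_nonneg (Finset.range_mono Q.le_succ) ?_).trans
    (sum_range_succ_inv_sqrt_le Q)
  intros
  positivity

lemma sum_range_sqrt_le (Q : ℕ) : ∑ r ∈ Finset.range Q, √(r : ℝ) ≤ Q * √(Q : ℝ) := by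
  calc _ ≤ ∑ r ∈ Finset.range Q, √(Q : ℝ) := by
        refine Finset.sum_le_sum fun r hr ↦ Real.sqrt_le_sqrt ?_
        exact_mod_cast (Finset.mem_range.1 hr).le
    _ = _ := by rw [Finset.sum_const, Finset.card_range, nsmul_eq_mul]

lemma norm_sum_unitExp_shift_sub_le {F : ℕ → ℝ} {c u : ℝ} (hu : 0 < u) (hc : 1 ≤ c)
    (h₁ : ∀ n, u ^ 6 ≤ F (n + 3) - 3 * F (n + 2) + 3 * F (n + 1) - F n)
    (h₂ : ∀ n, F (n + 3) - 3 * F (n + 2) + 3 * F (n + 1) - F n ≤ c * u ^ 6)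
    {r : ℕ} (hr : 0 < r) (N : ℕ) :
    ‖∑ n ∈ Finset.range N, unitExp (F (n + r) - F n)‖ ≤
      12 * (c * N * (u ^ 3 * √(r : ℝ)) + 1 / u ^ 3 * (1 / √(r : ℝ))) := by
  have hr' : (0 : ℝ) < r := Nat.cast_pos.2 hr
  set δ : ℕ → ℝ := fun n ↦ F (n + 2) - 2 * F (n + 1) + F n with hδ
  have hδ₁ : ∀ n, u ^ 6 ≤ δ (n + 1) - δ n := by
    intro n
    have := h₁ n
    simp only [hδ, add_assoc, Nat.reduceAdd]
    linarith
  have hδ₂ : ∀ n, δ (n + 1) - δ n ≤ c * u ^ 6 := by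
    intro n
    have := h₂ n
    simp only [hδ, add_assoc, Nat.reduceAdd]
    linarith
  have e : ∀ n, (F (n + 2 + r) - F (n + 2) - (F (n + 1 + r) - F (n + 1))) -
      (F (n + 1 + r) - F (n + 1) - (F (n + r) - F n)) = δ (n + r) - δ n := by
    intro n
    simp only [hδ]
    rw [show n + 2 + r = n + r + 2 by ring, show n + 1 + r = n + r + 1 by ring]
    ring
  have h := norm_sum_unitExp_le_of_second_diff (φ := fun n ↦ F (n + r) - F n) (l := u ^ 6 * r)
    (h := c) (by positivity) hc
    (fun n ↦ by rw [e]; exact mul_sub_le_sub_of_forall_le_succ hδ₁ n r)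
    (fun n ↦ by rw [e]; linarith [sub_le_mul_sub_of_forall_succ_le hδ₂ n r]) N
  have hs : √(u ^ 6 * r) = u ^ 3 * √(r : ℝ) := by
    rw [Real.sqrt_mul (by positivity), show u ^ 6 = (u ^ 3) ^ 2 by ring,
      Real.sqrt_sq (by positivity)]
  rw [hs] at h
  refine h.trans_eq ?_
  rw [one_div_mul_one_div]

lemma le_of_sq_mul_sq_le {c u x q S : ℝ} (hu : 0 < u) (hc : 1 ≤ c) (hx : 0 ≤ x)
    (hqge : 1 / u ≤ q) (hqle : q ≤ 2 / u) (hS0 : 0 ≤ S)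
    (hS : q ^ 2 * S ^ 2 ≤
      2 * (x + x) * (12 * (c * x * (u ^ 3 * (q ^ 2 * q)) + 1 / u ^ 3 * (2 * q)) + x)) :
    S ≤ 10 * (√c * x * u + √x / u) := by
  have hqpos : 0 < q := lt_of_lt_of_le (by positivity) hqge
  have hqinv : 1 / q ≤ u := by rw [div_le_iff₀ hqpos]; rwa [div_le_iff₀' hu] at hqge
  have e : 2 * (x + x) * (12 * (c * x * (u ^ 3 * (q ^ 2 * q)) + 1 / u ^ 3 * (2 * q)) + x) =
      q ^ 2 * (4 * x ^ 2 * (1 / q) ^ 2 + 48 * c * x ^ 2 * u ^ 3 * q +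
        96 * x * (1 / u ^ 3) * (1 / q)) := by
    field_simp
    ring
  rw [e] at hS
  have hS2 : S ^ 2 ≤ 100 * (c * x ^ 2 * u ^ 2 + x / u ^ 2) := by
    calc S ^ 2 ≤ 4 * x ^ 2 * (1 / q) ^ 2 + 48 * c * x ^ 2 * u ^ 3 * q +
          96 * x * (1 / u ^ 3) * (1 / q) := le_of_mul_le_mul_left hS (by positivity)
      _ ≤ 4 * x ^ 2 * u ^ 2 + 48 * c * x ^ 2 * u ^ 3 * (2 / u) + 96 * x * (1 / u ^ 3) * u := by
          gcongr
      _ = 4 * (1 * (x ^ 2 * u ^ 2)) + 96 * (c * (x ^ 2 * u ^ 2)) + 96 * (x / u ^ 2) := by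
          field_simp; ring
      _ ≤ 4 * (c * (x ^ 2 * u ^ 2)) + 96 * (c * (x ^ 2 * u ^ 2)) + 100 * (x / u ^ 2) := by
          gcongr; norm_num
      _ = _ := by ring
  refine (pow_le_pow_iff_left₀ hS0 (by positivity) two_ne_zero).1 ?_
  have hcs : √c ^ 2 = c := Real.sq_sqrt (by linarith)
  have hxs : √x ^ 2 = x := Real.sq_sqrt hx
  calc S ^ 2 ≤ 100 * (c * x ^ 2 * u ^ 2 + x / u ^ 2) := hS2
    _ = 100 * ((√c * x * u) ^ 2 + (√x / u) ^ 2) := by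
        rw [mul_pow, mul_pow, div_pow, hcs, hxs]
    _ ≤ 100 * (√c * x * u + √x / u) ^ 2 := by
        gcongr
        have : 0 ≤ (√c * x * u) * (√x / u) := by positivity
        linarith [add_sq (√c * x * u) (√x / u)]
    _ = _ := by ring

/-- The third-derivative test for a sequence whose third differences lie in
`[u ^ 6, c * u ^ 6]`. -/
lemma norm_sum_unitExp_le_of_third_diff {F : ℕ → ℝ} {c u : ℝ} (hu : 0 < u) (hu1 : u ≤ 1)
    (hc : 1 ≤ c)
    (h₁ : ∀ n, u ^ 6 ≤ F (n + 3) - 3 * F (n + 2) + 3 * F (n + 1) - F n)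
    (h₂ : ∀ n, F (n + 3) - 3 * F (n + 2) + 3 * F (n + 1) - F n ≤ c * u ^ 6) (N : ℕ) :
    ‖∑ n ∈ Finset.range N, unitExp (F n)‖ ≤ 10 * (√c * N * u + √(N : ℝ) / u) := by
  have hN0 : (0 : ℝ) ≤ N := N.cast_nonneg
  rcases lt_or_ge (N : ℝ) (1 / u ^ 2) with hN | hN
  · have h := norm_sum_unitExp_le_card (Finset.range N) F
    rw [Finset.card_range] at h
    have hs : √(N : ℝ) ≤ 1 / u :=
      Real.sqrt_le_iff.2 ⟨by positivity, by rw [div_pow, one_pow]; exact hN.le⟩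
    have h' : (N : ℝ) ≤ √(N : ℝ) / u := by
      calc (N : ℝ) = √(N : ℝ) * √(N : ℝ) := (Real.mul_self_sqrt hN0).symm
        _ ≤ √(N : ℝ) * (1 / u) := by gcongr
        _ = _ := by ring
    have : 0 ≤ √c * N * u := by positivity
    linarith [(norm_nonneg _).trans (h.trans h')]
  obtain ⟨Q, hQpos, hQN, hQge, hQle⟩ :
      ∃ Q : ℕ, 0 < Q ∧ (Q : ℝ) ≤ N ∧ 1 / u ^ 2 ≤ Q ∧ (Q : ℝ) ≤ 4 / u ^ 2 := by
    refine ⟨⌈1 / u ^ 2⌉₊, Nat.ceil_pos.2 (by positivity), Nat.cast_le.2 (Nat.ceil_le.2 hN),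
      Nat.le_ceil _, ?_⟩
    have := (Nat.ceil_lt_add_one (show 0 ≤ 1 / u ^ 2 by positivity)).le
    have h1 : 1 ≤ 1 / u ^ 2 := by
      rw [le_div_iff₀ (by positivity), one_mul]
      exact pow_le_one₀ hu.le hu1
    rw [show 4 / u ^ 2 = 4 * (1 / u ^ 2) by ring]
    linarith
  have hb : ∀ r < Q, ‖∑ n ∈ Finset.range (N - r),
      unitExp (F (n + r)) * (starRingEnd ℂ) (unitExp (F n))‖ ≤
      12 * (c * N * (u ^ 3 * √(r : ℝ)) + 1 / u ^ 3 * (1 / √(r : ℝ))) +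
        if r = 0 then (N : ℝ) else 0 := by
    intro r _
    simp only [← unitExp_sub]
    rcases Nat.eq_zero_or_pos r with rfl | hr
    · refine (norm_sum_unitExp_le_card _ _).trans ?_
      simp
    · refine (norm_sum_unitExp_shift_sub_le hu hc h₁ h₂ hr (N - r)).trans ?_
      rw [if_neg hr.ne', add_zero]
      gcongr
      exact Nat.sub_le _ _
  have hvdc := van_der_corput_inequality (z := fun n ↦ unitExp (F n)) hQpos hb
  obtain ⟨q, hq⟩ : ∃ q, q = √(Q : ℝ) := ⟨_, rfl⟩
  have hqQ : (Q : ℝ) = q ^ 2 := by rw [hq, Real.sq_sqrt Q.cast_nonneg]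
  have hqge : 1 / u ≤ q := hq ▸ Real.le_sqrt_of_sq_le (by rwa [div_pow, one_pow])
  have hqle : q ≤ 2 / u := by
    rw [hq, Real.sqrt_le_iff, div_pow]
    exact ⟨by positivity, hQle.trans_eq (by norm_num)⟩
  have hsum : ∑ r ∈ Finset.range Q,
      (12 * (c * N * (u ^ 3 * √(r : ℝ)) + 1 / u ^ 3 * (1 / √(r : ℝ))) +
        if r = 0 then (N : ℝ) else 0) ≤
      12 * (c * N * (u ^ 3 * (q ^ 2 * q)) + 1 / u ^ 3 * (2 * q)) + N := by
    rw [Finset.sum_add_distrib, ← Finset.mul_sum, Finset.sum_add_distrib, ← Finset.mul_sum,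
      ← Finset.mul_sum, ← Finset.mul_sum, Finset.sum_ite_eq' (Finset.range Q) 0 fun _ ↦ (N : ℝ),
      if_pos (Finset.mem_range.2 hQpos), ← hqQ, hq]
    gcongr
    · exact sum_range_sqrt_le Q
    · exact sum_range_inv_sqrt_le Q
  refine le_of_sq_mul_sq_le hu hc hN0 hqge hqle (norm_nonneg _) ?_
  rw [← hqQ] at hsum ⊢
  refine hvdc.trans (mul_le_mul (by linarith) hsum ?_ (by positivity))
  exact Finset.sum_nonneg fun r hr ↦ (norm_nonneg _).trans (hb r (Finset.mem_range.1 hr))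

lemma exists_sub_eq_of_hasDerivAt {g g' : ℝ → ℝ} {x : ℝ}
    (h : ∀ y ∈ Set.Icc x (x + 1), HasDerivAt g (g' y) y) :
    ∃ ξ ∈ Set.Icc x (x + 1), g (x + 1) - g x = g' ξ := by
  obtain ⟨ξ, hξ, e⟩ := exists_hasDerivAt_eq_slope g g' (lt_add_one x)
    (fun y hy ↦ (h y hy).continuousAt.continuousWithinAt)
    (fun y hy ↦ h y (Set.Ioo_subset_Icc_self hy))
  refine ⟨ξ, Set.Ioo_subset_Icc_self hξ, ?_⟩
  rw [e, add_sub_cancel_left, div_one]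

lemma exists_third_diff_eq_deriv {f : ℝ → ℝ} {x : ℝ}
    (h : ∀ y ∈ Set.Icc x (x + 3), DifferentiableAt ℝ f y ∧ DifferentiableAt ℝ (deriv f) y ∧
      DifferentiableAt ℝ (deriv (deriv f)) y) :
    ∃ ξ ∈ Set.Icc x (x + 3),
      f (x + 3) - 3 * f (x + 2) + 3 * f (x + 1) - f x = deriv (deriv (deriv f)) ξ := by
  obtain ⟨y, hy, ey⟩ := exists_sub_eq_of_hasDerivAt (x := x)
    (g := fun t ↦ f (t + 2) - 2 * f (t + 1) + f t)
    (g' := fun t ↦ deriv f (t + 2) - 2 * deriv f (t + 1) + deriv f t) fun t ht ↦ by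
      rw [Set.mem_Icc] at ht
      have d₀ := (h t ⟨by linarith, by linarith⟩).1.hasDerivAt
      have d₁ := (h (t + 1) ⟨by linarith, by linarith⟩).1.hasDerivAt.comp_add_const
      have d₂ := (h (t + 2) ⟨by linarith, by linarith⟩).1.hasDerivAt.comp_add_const
      exact (d₂.sub (d₁.const_mul 2)).add d₀
  rw [Set.mem_Icc] at hy
  obtain ⟨w, hw, ew⟩ := exists_sub_eq_of_hasDerivAt (x := y)
    (g := fun t ↦ deriv f (t + 1) - deriv f t)
    (g' := fun t ↦ deriv (deriv f) (t + 1) - deriv (deriv f) t) fun t ht ↦ by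
      rw [Set.mem_Icc] at ht
      have d₀ := (h t ⟨by linarith, by linarith⟩).2.1.hasDerivAt
      have d₁ := (h (t + 1) ⟨by linarith, by linarith⟩).2.1.hasDerivAt.comp_add_const
      exact d₁.sub d₀
  rw [Set.mem_Icc] at hw
  obtain ⟨ξ, hξ, eξ⟩ := exists_sub_eq_of_hasDerivAt (x := w) (g := deriv (deriv f))
    fun t ht ↦ by
      rw [Set.mem_Icc] at ht
      exact (h t ⟨by linarith, by linarith⟩).2.2.hasDerivAt
  rw [Set.mem_Icc] at hξ
  refine ⟨ξ, ⟨by linarith, by linarith⟩, ?_⟩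
  rw [← eξ, ← ew, add_assoc y, one_add_one_eq_two]
  simp only [add_assoc] at ey
  norm_num at ey
  linarith

lemma exists_extension_of_third_diff {F : ℕ → ℝ} {M : ℕ} {p q : ℝ} (hpq : p ≤ q)
    (h : ∀ n, n + 3 < M → p ≤ F (n + 3) - 3 * F (n + 2) + 3 * F (n + 1) - F n ∧
      F (n + 3) - 3 * F (n + 2) + 3 * F (n + 1) - F n ≤ q) :
    ∃ G : ℕ → ℝ, (∀ n < M, G n = F n) ∧
      ∀ n, p ≤ G (n + 3) - 3 * G (n + 2) + 3 * G (n + 1) - G n ∧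
        G (n + 3) - 3 * G (n + 2) + 3 * G (n + 1) - G n ≤ q := by
  set t : ℕ → ℝ := fun n ↦
    if n + 3 < M then F (n + 3) - 3 * F (n + 2) + 3 * F (n + 1) - F n else p with ht
  set d₂ : ℕ → ℝ := fun n ↦ F 2 - 2 * F 1 + F 0 + ∑ i ∈ Finset.range n, t i with hd₂
  set d₁ : ℕ → ℝ := fun n ↦ F 1 - F 0 + ∑ i ∈ Finset.range n, d₂ i with hd₁
  set G : ℕ → ℝ := fun n ↦ F 0 + ∑ i ∈ Finset.range n, d₁ i with hG
  have s₂ : ∀ n, d₂ (n + 1) = d₂ n + t n := fun n ↦ by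
    simp only [hd₂, Finset.sum_range_succ, add_assoc]
  have s₁ : ∀ n, d₁ (n + 1) = d₁ n + d₂ n := fun n ↦ by
    simp only [hd₁, Finset.sum_range_succ, add_assoc]
  have s₀ : ∀ n, G (n + 1) = G n + d₁ n := fun n ↦ by
    simp only [hG, Finset.sum_range_succ, add_assoc]
  have a₂ : ∀ n, n + 2 < M → d₂ n = F (n + 2) - 2 * F (n + 1) + F n := by
    intro n
    induction n with
    | zero => intro _; simp [hd₂]
    | succ n ih =>
      intro hn
      rw [s₂, ih (by omega)]
      simp only [ht]
      rw [if_pos (by omega)]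
      simp only [add_assoc, Nat.reduceAdd]
      ring
  have a₁ : ∀ n, n + 1 < M → d₁ n = F (n + 1) - F n := by
    intro n
    induction n with
    | zero => intro _; simp [hd₁]
    | succ n ih =>
      intro hn
      rw [s₁, ih (by omega), a₂ n (by omega)]
      simp only [add_assoc, Nat.reduceAdd]
      ring
  refine ⟨G, fun n ↦ ?_, fun n ↦ ?_⟩
  · induction n with
    | zero => intro _; simp [hG]
    | succ n ih =>
      intro hn
      rw [s₀, ih (by omega), a₁ n (by omega)]
      ring
  · have e : G (n + 3) - 3 * G (n + 2) + 3 * G (n + 1) - G n = t n := by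
      linarith [s₀ n, s₀ (n + 1), s₀ (n + 2), s₁ n, s₁ (n + 1), s₂ n]
    rw [e]
    simp only [ht]
    split_ifs with hn
    · exact h n hn
    · exact ⟨le_rfl, hpq⟩

theorem van_der_corput_third_derivative :
    ∃ C : ℝ, 0 < C ∧ ∀ (a b c Λ : ℝ) (f : ℝ → ℝ),
      a + 1 ≤ b → 1 < c → 0 < Λ →
      (∀ x ∈ Set.Icc a b, DifferentiableAt ℝ f x ∧ DifferentiableAt ℝ (deriv f) x ∧
        DifferentiableAt ℝ (deriv (deriv f)) x) →
      (∀ x ∈ Set.Icc a b, Λ ≤ deriv (deriv (deriv f)) x ∧ deriv (deriv (deriv f)) x ≤ c * Λ) →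
      ‖∑ n ∈ Finset.Ioc ⌊a⌋ ⌊b⌋, Complex.exp (2 * Real.pi * I * (f n))‖
        ≤ C * (c ^ ((1 : ℝ) / 2) * (b - a) * Λ ^ ((1 : ℝ) / 6)
            + (b - a) ^ ((1 : ℝ) / 2) * Λ ^ (-(1 : ℝ) / 6)) := by
  refine ⟨20, by norm_num, fun a b c Λ f hab hc hΛ hf hf3 ↦ ?_⟩
  set u : ℝ := Λ ^ ((1 : ℝ) / 6) with hu_def
  have hu : 0 < u := Real.rpow_pos_of_pos hΛ _
  have hu6 : u ^ 6 = Λ := by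
    rw [hu_def, ← Real.rpow_natCast, ← Real.rpow_mul hΛ.le]
    norm_num
  have hu' : Λ ^ (-(1 : ℝ) / 6) = 1 / u := by
    rw [neg_div, Real.rpow_neg hΛ.le, one_div u]
  rw [hu', ← Real.sqrt_eq_rpow, ← Real.sqrt_eq_rpow]
  set N : ℕ := (⌊b⌋ - ⌊a⌋).toNat with hN
  have hfl : ⌊a⌋ ≤ ⌊b⌋ := Int.floor_mono (by linarith)
  have hNcast : (N : ℤ) = ⌊b⌋ - ⌊a⌋ := Int.toNat_of_nonneg (by omega)
  have ha := Int.floor_le a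
  have ha' := Int.lt_floor_add_one a
  have hb := Int.floor_le b
  have hNreal : (N : ℝ) = ⌊b⌋ - ⌊a⌋ := by exact_mod_cast hNcast
  have hN2 : (N : ℝ) ≤ 2 * (b - a) := by linarith
  set F : ℕ → ℝ := fun n ↦ f (⌊a⌋ + 1 + n) with hF
  have hsum : ∑ n ∈ Finset.Ioc ⌊a⌋ ⌊b⌋, Complex.exp (2 * Real.pi * I * (f n)) =
      ∑ n ∈ Finset.range N, unitExp (F n) := by
    symm
    refine Finset.sum_bij (fun n _ ↦ ⌊a⌋ + 1 + (n : ℤ)) ?_ ?_ ?_ ?_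
    · intro n hn
      rw [Finset.mem_range] at hn
      rw [Finset.mem_Ioc]
      omega
    · intro m _ n _ h
      omega
    · intro m hm
      rw [Finset.mem_Ioc] at hm
      exact ⟨(m - ⌊a⌋ - 1).toNat, by rw [Finset.mem_range]; omega, by omega⟩
    · intro n _
      simp [hF, unitExp]
  rw [hsum]
  have hba : 1 ≤ b - a := by linarith
  have hc1 : 1 ≤ √c := Real.one_le_sqrt.2 hc.le
  rcases le_total u 1 with hu1 | hu1
  · have hdiff : ∀ n, n + 3 < N → Λ ≤ F (n + 3) - 3 * F (n + 2) + 3 * F (n + 1) - F n ∧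
        F (n + 3) - 3 * F (n + 2) + 3 * F (n + 1) - F n ≤ c * Λ := by
      intro n hn
      have hn' : (n : ℝ) + 3 + 1 ≤ N := by exact_mod_cast hn
      have hn0 : (0 : ℝ) ≤ n := n.cast_nonneg
      have hsub : Set.Icc (⌊a⌋ + 1 + n : ℝ) (⌊a⌋ + 1 + n + 3) ⊆ Set.Icc a b :=
        Set.Icc_subset_Icc (by linarith) (by linarith)
      obtain ⟨ξ, hξ, e⟩ := exists_third_diff_eq_deriv fun y hy ↦ hf y (hsub hy)
      have e' : F (n + 3) - 3 * F (n + 2) + 3 * F (n + 1) - F n =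
          deriv (deriv (deriv f)) ξ := by
        rw [← e]
        simp only [hF]
        push_cast
        simp only [add_assoc]
      rw [e']
      exact hf3 ξ (hsub hξ)
    obtain ⟨G, hGF, hG⟩ := exists_extension_of_third_diff
      (le_mul_of_one_le_left hΛ.le hc.le) hdiff
    rw [Finset.sum_congr rfl fun n hn ↦ by rw [← hGF n (Finset.mem_range.1 hn)]]
    have h := norm_sum_unitExp_le_of_third_diff hu hu1 hc.le
      (fun n ↦ hu6.symm ▸ (hG n).1) (fun n ↦ hu6.symm ▸ (hG n).2) N
    have hsN : √(N : ℝ) ≤ 2 * √(b - a) := by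
      rw [Real.sqrt_le_iff, mul_pow, Real.sq_sqrt (by linarith)]
      exact ⟨by positivity, by linarith⟩
    calc _ ≤ 10 * (√c * N * u + √(N : ℝ) / u) := h
      _ ≤ 10 * (√c * (2 * (b - a)) * u + 2 * √(b - a) / u) := by gcongr
      _ = _ := by ring
  · have h := norm_sum_unitExp_le_card (Finset.range N) F
    rw [Finset.card_range] at h
    have h1 : b - a ≤ √c * (b - a) := le_mul_of_one_le_left (by linarith) hc1
    have h2 : √c * (b - a) ≤ √c * (b - a) * u := le_mul_of_one_le_right (by linarith) hu1
    have h3 : 0 ≤ √(b - a) * (1 / u) := by positivity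
    linarith
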